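/- For all i ∈ {1,…,n}, all k ≥ 1 and all S ⊆ I, both e_i^k·v_S and f_i^k·v_S lie in [k]_{q_i}!·Λ_A; equivalently, the divided powers e_i^{(k)} := e_i^k/[k]_{q_i}! and f_i^{(k)} := f_i^k/[k]_{q_i}! map the A-lattice Λ_A into itself. -/

import Mathlib

noncomputable section

/-- The field `𝔽 = ℚ(q)`. -/
abbrev Fq : Type := RatFunc ℚ

/-- The quantum parameter `q`. -/
def qv : Fq := RatFunc.X

/-- The index set `I = {1,…,n} ∪ {−n,…,−1}` as a finset of integers. -/
def Iset (n : ℕ) : Finset ℤ := (Finset.Icc (-(n : ℤ)) (n : ℤ)).erase 0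

/-- Subsets of `I`, the index type for the standard basis. -/
abbrev Bset (n : ℕ) : Type := {S : Finset ℤ // S ⊆ Iset n}

/-- `Λ`, the free `𝔽`-vector space with basis `{v_S : S ⊆ I}`. -/
abbrev Lam (n : ℕ) : Type := Bset n →₀ Fq

/-- The standard basis vector `v_S`. -/
def bv (n : ℕ) (S : Bset n) : Lam n := Finsupp.single S 1

/-- The standard basis vector `v_T` for a finset `T ⊆ I` (and `0` for junk input). -/
def vS (n : ℕ) (T : Finset ℤ) : Lam n :=
  if h : T ⊆ Iset n then Finsupp.single (⟨T, h⟩ : Bset n) (1 : Fq) else 0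

/-- The linear operator on `Λ` determined by prescribed values on the standard basis. -/
def mkOp (n : ℕ) (g : Bset n → Lam n) : Module.End Fq (Lam n) :=
  Finsupp.linearCombination Fq g

/-- The four positions `{i, i+1, −i, −(i+1)}`. -/
def quad (i : ℤ) : Finset ℤ := {i, i + 1, -i, -(i + 1)}

/-- Value of `f_i` on `v_S`. -/
def fAct (n : ℕ) (i : ℤ) (S : Finset ℤ) : Lam n :=
  if i = (n : ℤ) then
    (if (n : ℤ) ∈ S ∧ -(n : ℤ) ∉ S then vS n (insert (-(n : ℤ)) (S.erase (n : ℤ))) else 0)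
  else
    (if S ∩ quad i = {i} then vS n (insert (i + 1) (S.erase i))
     else if S ∩ quad i = {-(i + 1)} then vS n (insert (-i) (S.erase (-(i + 1))))
     else if S ∩ quad i = ({i, -(i + 1)} : Finset ℤ) then
       vS n (insert (-i) (S.erase (-(i + 1)))) + qv⁻¹ • vS n (insert (i + 1) (S.erase i))
     else if S ∩ quad i = ({i, -i} : Finset ℤ) then qv • vS n (insert (i + 1) (S.erase i))
     else if S ∩ quad i = ({i + 1, -(i + 1)} : Finset ℤ) then
       vS n (insert (-i) (S.erase (-(i + 1))))
     else if S ∩ quad i = ({i, -(i + 1), -i} : Finset ℤ) then vS n (insert (i + 1) (S.erase i))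
     else if S ∩ quad i = ({i, i + 1, -(i + 1)} : Finset ℤ) then
       vS n (insert (-i) (S.erase (-(i + 1))))
     else 0)

/-- Value of `e_i` on `v_S`. -/
def eAct (n : ℕ) (i : ℤ) (S : Finset ℤ) : Lam n :=
  if i = (n : ℤ) then
    (if -(n : ℤ) ∈ S ∧ (n : ℤ) ∉ S then vS n (insert (n : ℤ) (S.erase (-(n : ℤ)))) else 0)
  else
    (if S ∩ quad i = {-i} then vS n (insert (-(i + 1)) (S.erase (-i)))
     else if S ∩ quad i = {i + 1} then vS n (insert i (S.erase (i + 1)))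
     else if S ∩ quad i = ({i + 1, -i} : Finset ℤ) then
       vS n (insert i (S.erase (i + 1))) + qv⁻¹ • vS n (insert (-(i + 1)) (S.erase (-i)))
     else if S ∩ quad i = ({i, -i} : Finset ℤ) then qv • vS n (insert (-(i + 1)) (S.erase (-i)))
     else if S ∩ quad i = ({i + 1, -(i + 1)} : Finset ℤ) then vS n (insert i (S.erase (i + 1)))
     else if S ∩ quad i = ({i, i + 1, -i} : Finset ℤ) then
       vS n (insert (-(i + 1)) (S.erase (-i)))
     else if S ∩ quad i = ({i + 1, -(i + 1), -i} : Finset ℤ) then vS n (insert i (S.erase (i + 1)))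
     else 0)

/-- Coefficient of `ε_j` in `wt(S)`. -/
def epsCoef (S : Finset ℤ) (j : ℤ) : ℤ :=
  (if j ∈ S then 1 else 0) - (if -j ∈ S then 1 else 0)

/-- The pairing `(α_i, wt S)`. -/
def alphaPair (n : ℕ) (i : ℤ) (S : Finset ℤ) : ℤ :=
  if i = (n : ℤ) then 2 * epsCoef S (n : ℤ) else epsCoef S i - epsCoef S (i + 1)

/-- The operator `f_i` on `Λ`. -/
def fop (n : ℕ) (i : ℤ) : Module.End Fq (Lam n) := mkOp n (fun S => fAct n i S.1)

/-- The operator `e_i` on `Λ`. -/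
def eop (n : ℕ) (i : ℤ) : Module.End Fq (Lam n) := mkOp n (fun S => eAct n i S.1)

/-- The operator `k_i` on `Λ`, `k_i · v_S = q^{(α_i, wt S)} v_S`. -/
def kop (n : ℕ) (i : ℤ) : Module.End Fq (Lam n) :=
  mkOp n (fun S => (qv ^ alphaPair n i S.1) • bv n S)

/-- The operator `k_i⁻¹` on `Λ`. -/
def kinvop (n : ℕ) (i : ℤ) : Module.End Fq (Lam n) :=
  mkOp n (fun S => (qv ^ (-alphaPair n i S.1)) • bv n S)

/-- `−S`. -/
def negSet (S : Finset ℤ) : Finset ℤ := S.image (fun x => -x)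

/-- `S₀ = S ∩ (−S)`, the fully dotted columns. -/
def Szero (S : Finset ℤ) : Finset ℤ := S ∩ negSet S

/-- `S₀^c = (I∖S) ∩ (−(I∖S))`, the undotted columns. -/
def Szeroc (n : ℕ) (S : Finset ℤ) : Finset ℤ := (Iset n \ S) ∩ negSet (Iset n \ S)

/-- `w(S) = (|S₀| − |S₀^c|)/2`. -/
def wTot (n : ℕ) (S : Finset ℤ) : ℤ :=
  (((Szero S).card : ℤ) - ((Szeroc n S).card : ℤ)) / 2

/-- `w_{>i}(S)`. -/
def wGt (n : ℕ) (i : ℤ) (S : Finset ℤ) : ℤ :=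
  ((((Szero S).filter (fun x => i < |x| ∧ |x| ≤ (n : ℤ))).card : ℤ)
    - (((Szeroc n S).filter (fun x => i < |x| ∧ |x| ≤ (n : ℤ))).card : ℤ)) / 2

/-- `w_{<i}(S)`. -/
def wLt (n : ℕ) (i : ℤ) (S : Finset ℤ) : ℤ :=
  ((((Szeroc n S).filter (fun x => x ≠ 0 ∧ |x| < i)).card : ℤ)
    - (((Szero S).filter (fun x => x ≠ 0 ∧ |x| < i)).card : ℤ)) / 2

/-- Value of `E` on `v_S`. -/
def EAct (n : ℕ) (S : Finset ℤ) : Lam n :=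
  ∑ i ∈ (Finset.Icc (1 : ℤ) (n : ℤ)).filter (fun i => i ∈ Szeroc n S ∧ -i ∈ Szeroc n S),
    ((-qv) ^ wGt n i S) • vS n (insert i (insert (-i) S))

/-- Value of `F` on `v_S`. -/
def FAct (n : ℕ) (S : Finset ℤ) : Lam n :=
  ∑ i ∈ (Finset.Icc (1 : ℤ) (n : ℤ)).filter (fun i => i ∈ Szero S ∧ -i ∈ Szero S),
    ((-qv) ^ wLt n i S) • vS n ((S.erase i).erase (-i))

/-- The operator `E` on `Λ`. -/
def Eop (n : ℕ) : Module.End Fq (Lam n) := mkOp n (fun S => EAct n S.1)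

/-- The operator `F` on `Λ`. -/
def Fop (n : ℕ) : Module.End Fq (Lam n) := mkOp n (fun S => FAct n S.1)

/-- The operator `K` on `Λ`, `K · v_S = (−q)^{w(S)} v_S`. -/
def Kop (n : ℕ) : Module.End Fq (Lam n) := mkOp n (fun S => ((-qv) ^ wTot n S.1) • bv n S)

/-- The operator `K⁻¹` on `Λ`. -/
def Kinvop (n : ℕ) : Module.End Fq (Lam n) :=
  mkOp n (fun S => ((-qv) ^ (-wTot n S.1)) • bv n S)

/-- Balanced quantum integer `[m]_x`. -/
def qNum (x : Fq) (m : ℕ) : Fq := (x ^ (m : ℤ) - x ^ (-(m : ℤ))) / (x - x⁻¹)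

/-- Quantum factorial `[m]_x!`. -/
def qFact (x : Fq) (m : ℕ) : Fq := ∏ j ∈ Finset.range m, qNum x (j + 1)

/-- Gaussian binomial coefficient in the variable `x`. -/
def qBinom (x : Fq) (m s : ℕ) : Fq := qFact x m / (qFact x s * qFact x (m - s))

/-- The variable `q_i`: `q` for `i < n` and `q²` for `i = n`. -/
def qsub (n : ℕ) (i : ℤ) : Fq := if i = (n : ℤ) then qv ^ 2 else qv

/-- The subring `A = ℤ[q,q⁻¹] ⊆ 𝔽`. -/
def Asub : Subring Fq := Subring.closure {qv, qv⁻¹}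

/-- The `A`-lattice `Λ_A ⊆ Λ`: the `A`-span of all `v_S`. -/
def LamA (n : ℕ) : Set (Lam n) :=
  {x | ∃ c : Bset n →₀ Fq, (∀ S, c S ∈ Asub) ∧ x = c.sum (fun S a => a • bv n S)}

/-- The degree-`k` part `Λ^k ⊆ Λ`. -/
def Lk (n k : ℕ) : Submodule Fq (Lam n) :=
  Submodule.span Fq {x | ∃ S : Bset n, S.1.card = k ∧ x = bv n S}

/-- The divided power `E^{(m)} = E^m/[m]!`. -/
def Ediv (n : ℕ) (m : ℕ) : Module.End Fq (Lam n) := (qFact qv m)⁻¹ • (Eop n ^ m)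

/-- The divided power `F^{(m)} = F^m/[m]!`. -/
def Fdiv (n : ℕ) (m : ℕ) : Module.End Fq (Lam n) := (qFact qv m)⁻¹ • (Fop n ^ m)

lemma mem_LamA_iff {n : ℕ} {x : Lam n} : x ∈ LamA n ↔ ∀ S, x S ∈ Asub := by
  have sum_bv : ∀ c : Bset n →₀ Fq, c.sum (fun S a => a • bv n S) = c := fun c => by
    simp [bv]
  constructor
  · rintro ⟨c, hc, rfl⟩
    simpa only [sum_bv] using hc
  · intro h
    exact ⟨x, h, (sum_bv x).symm⟩

lemma zero_mem_LamA (n : ℕ) : (0 : Lam n) ∈ LamA n :=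
  mem_LamA_iff.2 fun _ => zero_mem _

lemma add_mem_LamA {n : ℕ} {x y : Lam n} (hx : x ∈ LamA n) (hy : y ∈ LamA n) :
    x + y ∈ LamA n :=
  mem_LamA_iff.2 fun S => add_mem (mem_LamA_iff.1 hx S) (mem_LamA_iff.1 hy S)

lemma smul_mem_LamA {n : ℕ} {a : Fq} {x : Lam n} (ha : a ∈ Asub) (hx : x ∈ LamA n) :
    a • x ∈ LamA n :=
  mem_LamA_iff.2 fun S => mul_mem ha (mem_LamA_iff.1 hx S)

lemma bv_mem_LamA (n : ℕ) (S : Bset n) : bv n S ∈ LamA n := by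
  classical
  refine mem_LamA_iff.2 fun T => ?_
  rw [bv, Finsupp.single_apply]
  split_ifs
  exacts [one_mem _, zero_mem _]

lemma vS_mem_LamA (n : ℕ) (T : Finset ℤ) : vS n T ∈ LamA n := by
  unfold vS
  split_ifs with h
  exacts [bv_mem_LamA n ⟨T, h⟩, zero_mem_LamA n]

lemma mkOp_bv (n : ℕ) (g : Bset n → Lam n) (S : Bset n) : mkOp n g (bv n S) = g S := by
  simp [mkOp, bv]

lemma mkOp_mem_LamA {n : ℕ} {g : Bset n → Lam n} (hg : ∀ S, g S ∈ LamA n) {x : Lam n}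
    (hx : x ∈ LamA n) : mkOp n g x ∈ LamA n := by
  rw [mkOp, Finsupp.linearCombination_apply]
  exact Finset.sum_induction _ (· ∈ LamA n) (fun _ _ => add_mem_LamA) (zero_mem_LamA n)
    fun S _ => smul_mem_LamA (mem_LamA_iff.1 hx S) (hg S)

lemma end_ext_bv {n : ℕ} {f g : Module.End Fq (Lam n)} (h : ∀ S, f (bv n S) = g (bv n S)) :
    f = g :=
  Finsupp.lhom_ext' fun S => LinearMap.ext_ring (h S)

lemma qv_ne_zero : qv ≠ 0 := RatFunc.X_ne_zero

lemma qv_pow_ne_one {m : ℕ} (hm : m ≠ 0) : qv ^ m ≠ 1 := by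
  intro h
  have h' : algebraMap (Polynomial ℚ) (RatFunc ℚ) (Polynomial.X ^ m)
      = algebraMap (Polynomial ℚ) (RatFunc ℚ) 1 := by
    simpa [qv] using h
  have := congrArg Polynomial.natDegree (RatFunc.algebraMap_injective ℚ h')
  simp at this
  exact hm this

lemma qv_mem_Asub : qv ∈ Asub := Subring.subset_closure (by simp)

lemma inv_qv_mem_Asub : qv⁻¹ ∈ Asub := Subring.subset_closure (by simp)

lemma qFact_one {x : Fq} (hx : x - x⁻¹ ≠ 0) : qFact x 1 = 1 := by
  simp [qFact, qNum, hx]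

lemma qFact_two {x : Fq} (hx : x - x⁻¹ ≠ 0) : qFact x 2 = x + x⁻¹ := by
  have h : qNum x 2 = x + x⁻¹ := by
    rw [qNum, div_eq_iff hx]
    simp only [Nat.cast_ofNat, zpow_neg, zpow_ofNat, ← inv_pow]
    ring
  have h1 : qNum x 1 = 1 := by simpa [qFact] using qFact_one hx
  simp [qFact, Finset.prod_range_succ, h, h1]

/-- If `T² = [2]_x U` and `T³ = 0`, where `T` and `U` preserve `Λ_A`, then so do all divided
powers of `T`. -/
lemma exists_divided_power {n : ℕ} {T U : Module.End Fq (Lam n)} {x : Fq} (hx : x ^ 4 ≠ 1)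
    (hx0 : x ≠ 0) (hT : ∀ v ∈ LamA n, T v ∈ LamA n) (hU : ∀ v ∈ LamA n, U v ∈ LamA n)
    (h2 : T ^ 2 = (x + x⁻¹) • U) (h3 : T ^ 3 = 0) {k : ℕ} (hk : 1 ≤ k) :
    ∃ D : Module.End Fq (Lam n), (∀ v ∈ LamA n, D v ∈ LamA n) ∧
      T ^ k = qFact x k • D ∧ (qFact x k)⁻¹ • T ^ k = D := by
  have hsub : x - x⁻¹ ≠ 0 := by
    intro h
    apply hx
    have : x * x = 1 := by
      field_simp at h
      linear_combination h
    linear_combination (x * x + 1) * this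
  have hadd : x + x⁻¹ ≠ 0 := by
    intro h
    apply hx
    have : x * x = -1 := by
      field_simp at h
      linear_combination h
    linear_combination (x * x - 1) * this
  obtain rfl | rfl | hk : k = 1 ∨ k = 2 ∨ 3 ≤ k := by omega
  · exact ⟨T, hT, by simp [qFact_one hsub], by simp [qFact_one hsub]⟩
  · refine ⟨U, hU, ?_, ?_⟩
    · rw [qFact_two hsub, h2]
    · rw [qFact_two hsub, h2, smul_smul, inv_mul_cancel₀ hadd, one_smul]
  · have hT0 : T ^ k = 0 := pow_eq_zero_of_le hk h3
    exact ⟨0, fun _ _ => zero_mem_LamA n, by simp [hT0], by simp [hT0]⟩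

/-- The operator moving the element `a` of a set to the free position `b`, weighted by `w`. -/
def moveOp (n : ℕ) (a b : ℤ) (w : Finset ℤ → Fq) : Module.End Fq (Lam n) :=
  mkOp n fun S => if a ∈ S.1 ∧ b ∉ S.1 then w S.1 • vS n (insert b (S.1.erase a)) else 0

lemma moveOp_mem_LamA {n : ℕ} {a b : ℤ} {w : Finset ℤ → Fq} (hw : ∀ S, w S ∈ Asub)
    (v : Lam n) (hv : v ∈ LamA n) : moveOp n a b w v ∈ LamA n := by
  refine mkOp_mem_LamA (fun S => ?_) hv
  split_ifs
  exacts [smul_mem_LamA (hw _) (vS_mem_LamA _ _), zero_mem_LamA n]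

lemma moveOp_bv (n : ℕ) (a b : ℤ) (w : Finset ℤ → Fq) (S : Bset n) :
    moveOp n a b w (bv n S)
      = if a ∈ S.1 ∧ b ∉ S.1 then w S.1 • vS n (insert b (S.1.erase a)) else 0 :=
  mkOp_bv n _ S

lemma moveOp_vS {n : ℕ} {a b : ℤ} (w : Finset ℤ → Fq) {T : Finset ℤ} (hT : T ⊆ Iset n) :
    moveOp n a b w (vS n T)
      = if a ∈ T ∧ b ∉ T then w T • vS n (insert b (T.erase a)) else 0 := by
  have : vS n T = bv n ⟨T, hT⟩ := by simp [vS, hT, bv]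
  rw [this, moveOp_bv]

lemma insert_erase_subset {n : ℕ} {a b : ℤ} {T : Finset ℤ} (hb : b ∈ Iset n)
    (hT : T ⊆ Iset n) : insert b (T.erase a) ⊆ Iset n :=
  Finset.insert_subset hb ((Finset.erase_subset _ _).trans hT)

lemma moveOp_sq {n : ℕ} {a b : ℤ} (w : Finset ℤ → Fq) (hb : b ∈ Iset n) :
    moveOp n a b w * moveOp n a b w = 0 := by
  refine end_ext_bv fun S => ?_
  rw [Module.End.mul_apply, moveOp_bv]
  split_ifs with h
  · rw [map_smul, moveOp_vS w (insert_erase_subset hb S.2)]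
    simp
  · simp

/-- The weight of the move `a → b` in the presence of the positions `c` and `d`. -/
def moveWeight (c d : ℤ) (S : Finset ℤ) : Fq :=
  if c ∈ S then (if d ∈ S then 1 else qv⁻¹) else (if d ∈ S then qv else 1)

lemma moveWeight_mem_Asub (c d : ℤ) (S : Finset ℤ) : moveWeight c d S ∈ Asub := by
  unfold moveWeight
  split_ifs
  exacts [one_mem _, inv_qv_mem_Asub, qv_mem_Asub, one_mem _]

/-- Four pairwise distinct positions in `I`. -/
structure IsQuad (n : ℕ) (a b c d : ℤ) : Prop where
  b_mem : b ∈ Iset n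
  d_mem : d ∈ Iset n
  ab : a ≠ b
  ac : a ≠ c
  ad : a ≠ d
  bc : b ≠ c
  bd : b ≠ d
  cd : c ≠ d

lemma moveOp_q_comm {n : ℕ} {a b c d : ℤ} (h : IsQuad n a b c d) :
    moveOp n c d 1 * moveOp n a b (moveWeight c d)
      = (qv⁻¹ * qv⁻¹) • (moveOp n a b (moveWeight c d) * moveOp n c d 1) := by
  obtain ⟨hb, hd, hab, hac, had, hbc, hbd, hcd⟩ := h
  refine end_ext_bv fun S => ?_
  rw [LinearMap.smul_apply, Module.End.mul_apply, Module.End.mul_apply, moveOp_bv, moveOp_bv]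
  have hset : insert d ((insert b (S.1.erase a)).erase c)
      = insert b ((insert d (S.1.erase c)).erase a) := by
    ext x
    simp only [Finset.mem_insert, Finset.mem_erase]
    grind
  by_cases h1 : a ∈ S.1 ∧ b ∉ S.1 <;> by_cases h2 : c ∈ S.1 ∧ d ∉ S.1
  · rw [if_pos h1, if_pos h2, map_smul, map_smul, moveOp_vS _ (insert_erase_subset hb S.2),
      moveOp_vS _ (insert_erase_subset hd S.2)]
    obtain ⟨ha', hb'⟩ := h1
    obtain ⟨hc', hd'⟩ := h2
    simp [moveWeight, hset, ha', hb', hc', hd', smul_smul, qv_ne_zero, hac, had, hbc,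
      hbd, hcd.symm, hac.symm, had.symm, hbd.symm, hbc.symm, hcd]
  · rw [if_pos h1, if_neg h2, map_smul, moveOp_vS _ (insert_erase_subset hb S.2), if_neg]
    · simp
    · simp only [Finset.mem_insert, Finset.mem_erase]
      grind
  · rw [if_neg h1, if_pos h2, map_smul, moveOp_vS _ (insert_erase_subset hd S.2), if_neg]
    · simp
    · simp only [Finset.mem_insert, Finset.mem_erase]
      grind
  · rw [if_neg h1, if_neg h2]
    simp

lemma exists_divided_power_add_moveOp {n : ℕ} {a b c d : ℤ} (h : IsQuad n a b c d) {k : ℕ}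
    (hk : 1 ≤ k) :
    ∃ D : Module.End Fq (Lam n), (∀ v ∈ LamA n, D v ∈ LamA n) ∧
      (moveOp n a b (moveWeight c d) + moveOp n c d 1) ^ k = qFact qv k • D ∧
      (qFact qv k)⁻¹ • (moveOp n a b (moveWeight c d) + moveOp n c d 1) ^ k = D := by
  have hX := moveOp_sq (a := a) (moveWeight c d) h.b_mem
  have hY := moveOp_sq (a := c) 1 h.d_mem
  have hYX := moveOp_q_comm h
  have hXL := moveOp_mem_LamA (n := n) (a := a) (b := b) (moveWeight_mem_Asub c d)
  have hYL := moveOp_mem_LamA (n := n) (a := c) (b := d) (w := 1) fun _ => one_mem _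
  generalize moveOp n a b (moveWeight c d) = X at *
  generalize moveOp n c d 1 = Y at *
  have h2 : (X + Y) ^ 2 = (qv + qv⁻¹) • (qv⁻¹ • (X * Y)) := by
    rw [sq, mul_add, add_mul, add_mul, hX, hY, hYX, smul_smul, add_mul,
      mul_inv_cancel₀ qv_ne_zero, add_smul, one_smul]
    abel
  refine exists_divided_power (qv_pow_ne_one four_ne_zero) qv_ne_zero
    (fun v hv => add_mem_LamA (hXL v hv) (hYL v hv))
    (fun v hv => smul_mem_LamA inv_qv_mem_Asub (hXL _ (hYL v hv))) h2 ?_ hk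
  have hXYX : X * Y * X = 0 := by
    rw [mul_assoc, hYX, mul_smul_comm, ← mul_assoc, hX, zero_mul, smul_zero]
  rw [pow_succ, h2, smul_mul_assoc, smul_mul_assoc, mul_add, hXYX, mul_assoc, hY]
  simp

lemma exists_divided_power_moveOp {n : ℕ} {a b : ℤ} (hb : b ∈ Iset n) {k : ℕ} (hk : 1 ≤ k) :
    ∃ D : Module.End Fq (Lam n), (∀ v ∈ LamA n, D v ∈ LamA n) ∧
      moveOp n a b 1 ^ k = qFact (qv ^ 2) k • D ∧
      (qFact (qv ^ 2) k)⁻¹ • moveOp n a b 1 ^ k = D := by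
  have h2 : moveOp n a b 1 ^ 2 = 0 := by rw [sq, moveOp_sq 1 hb]
  refine exists_divided_power (U := 0) ?_ (pow_ne_zero 2 qv_ne_zero)
    (moveOp_mem_LamA fun _ => one_mem _) (fun _ _ => zero_mem_LamA n) (h2.trans (smul_zero _).symm)
    (pow_eq_zero_of_le (by norm_num) h2) hk
  rw [← pow_mul]
  exact qv_pow_ne_one (by norm_num)

lemma mem_Iset {n : ℕ} {x : ℤ} : x ∈ Iset n ↔ x ≠ 0 ∧ -(n : ℤ) ≤ x ∧ x ≤ n := by
  simp [Iset]

lemma inter_quad_eq_iff (i : ℤ) (S P : Finset ℤ) :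
    S ∩ quad i = P ↔ P ⊆ quad i ∧ (i ∈ S ↔ i ∈ P) ∧ (i + 1 ∈ S ↔ i + 1 ∈ P) ∧
      (-i ∈ S ↔ -i ∈ P) ∧ (-(i + 1) ∈ S ↔ -(i + 1) ∈ P) := by
  constructor
  · rintro rfl
    exact ⟨Finset.inter_subset_right, by simp [quad]⟩
  · rintro ⟨hP, h1, h2, h3, h4⟩
    have hiff : ∀ x ∈ quad i, (x ∈ S ↔ x ∈ P) := by
      simpa [quad] using ⟨h1, h2, h3, by simpa using h4⟩
    ext x
    rw [Finset.mem_inter]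
    exact ⟨fun hx => (hiff x hx.2).1 hx.1, fun hx => ⟨(hiff x (hP hx)).2 hx, hP hx⟩⟩

lemma fop_eq_moveOp_add {n : ℕ} {i : ℤ} (hi : 1 ≤ i) (hin : i ≠ n) :
    fop n i = moveOp n i (i + 1) (moveWeight (-(i + 1)) (-i)) + moveOp n (-(i + 1)) (-i) 1 := by
  refine end_ext_bv fun S => ?_
  rw [LinearMap.add_apply, moveOp_bv, moveOp_bv, fop, mkOp_bv, fAct, if_neg hin]
  have e1 : i ≠ -i := by omega
  have e2 : i ≠ -(i + 1) := by omega
  have e3 : i + 1 ≠ -i := by omega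
  have e4 : i + 1 ≠ -(i + 1) := by omega
  have e5 : -i ≠ -(i + 1) := by omega
  have e6 : i + 1 ≠ i := by omega
  simp only [inter_quad_eq_iff]
  simp only [quad, Finset.insert_subset_iff, Finset.singleton_subset_iff,
    Finset.mem_insert, Finset.mem_singleton, e1, e2, e3, e4, e5, e6, e1.symm, e2.symm,
    e3.symm, e4.symm, e5.symm, e6.symm, moveWeight]
  by_cases h1 : i ∈ S.1 <;> by_cases h2 : i + 1 ∈ S.1 <;> by_cases h3 : -i ∈ S.1 <;>
    by_cases h4 : -(i + 1) ∈ S.1 <;> simp only [h1, h2, h3, h4] <;> simp [add_comm]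

lemma eop_eq_moveOp_add {n : ℕ} {i : ℤ} (hi : 1 ≤ i) (hin : i ≠ n) :
    eop n i = moveOp n (-i) (-(i + 1)) (moveWeight (i + 1) i) + moveOp n (i + 1) i 1 := by
  refine end_ext_bv fun S => ?_
  rw [LinearMap.add_apply, moveOp_bv, moveOp_bv, eop, mkOp_bv, eAct, if_neg hin]
  have e1 : i ≠ -i := by omega
  have e2 : i ≠ -(i + 1) := by omega
  have e3 : i + 1 ≠ -i := by omega
  have e4 : i + 1 ≠ -(i + 1) := by omega
  have e5 : -i ≠ -(i + 1) := by omega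
  have e6 : i + 1 ≠ i := by omega
  simp only [inter_quad_eq_iff]
  simp only [quad, Finset.insert_subset_iff, Finset.singleton_subset_iff,
    Finset.mem_insert, Finset.mem_singleton, e1, e2, e3, e4, e5, e6, e1.symm, e2.symm,
    e3.symm, e4.symm, e5.symm, e6.symm, moveWeight]
  by_cases h1 : i ∈ S.1 <;> by_cases h2 : i + 1 ∈ S.1 <;> by_cases h3 : -i ∈ S.1 <;>
    by_cases h4 : -(i + 1) ∈ S.1 <;> simp only [h1, h2, h3, h4] <;> simp [add_comm]

lemma fop_self (n : ℕ) : fop n n = moveOp n n (-n) 1 :=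
  end_ext_bv fun S => by simp [moveOp_bv, fop, mkOp_bv, fAct]

lemma eop_self (n : ℕ) : eop n n = moveOp n (-n) n 1 :=
  end_ext_bv fun S => by simp [moveOp_bv, eop, mkOp_bv, eAct]

lemma exists_divided_power_eop_fop {n : ℕ} {i : ℤ} (hi : i ∈ Finset.Icc (1 : ℤ) n) {k : ℕ}
    (hk : 1 ≤ k) :
    (∃ D : Module.End Fq (Lam n), (∀ v ∈ LamA n, D v ∈ LamA n) ∧
      eop n i ^ k = qFact (qsub n i) k • D ∧ (qFact (qsub n i) k)⁻¹ • eop n i ^ k = D) ∧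
    (∃ D : Module.End Fq (Lam n), (∀ v ∈ LamA n, D v ∈ LamA n) ∧
      fop n i ^ k = qFact (qsub n i) k • D ∧ (qFact (qsub n i) k)⁻¹ • fop n i ^ k = D) := by
  obtain ⟨h1, h2⟩ := Finset.mem_Icc.1 hi
  by_cases hin : i = n
  · subst hin
    rw [qsub, if_pos rfl, eop_self, fop_self]
    exact ⟨exists_divided_power_moveOp (mem_Iset.2 (by omega)) hk,
      exists_divided_power_moveOp (mem_Iset.2 (by omega)) hk⟩
  · rw [qsub, if_neg hin, eop_eq_moveOp_add h1 hin, fop_eq_moveOp_add h1 hin]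
    constructor <;> refine exists_divided_power_add_moveOp ?_ hk <;> constructor <;>
      first
      | (rw [mem_Iset]; omega)
      | omega

/-- e_i^k·v_S and f_i^k·v_S lie in [k]_{q_i}!·Λ_A; equivalently, the divided
powers e_i^{(k)} and f_i^{(k)} map the A-lattice Λ_A into itself. -/
theorem stmt6 (n : ℕ) (hn : 1 ≤ n) :
    ∀ i ∈ Finset.Icc (1 : ℤ) (n : ℤ), ∀ k : ℕ, 1 ≤ k →
      (∀ S : Bset n,
        (∃ y ∈ LamA n, (eop n i ^ k) (bv n S) = qFact (qsub n i) k • y) ∧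
        (∃ y ∈ LamA n, (fop n i ^ k) (bv n S) = qFact (qsub n i) k • y)) ∧
      (∀ x ∈ LamA n,
        (qFact (qsub n i) k)⁻¹ • ((eop n i ^ k) x) ∈ LamA n ∧
        (qFact (qsub n i) k)⁻¹ • ((fop n i ^ k) x) ∈ LamA n) := by
  intro i hi k hk
  obtain ⟨⟨D, hD, hD1, hD2⟩, ⟨D', hD', hD1', hD2'⟩⟩ := exists_divided_power_eop_fop hi hk
  refine ⟨fun S => ⟨⟨D (bv n S), hD _ (bv_mem_LamA n S), by rw [hD1]; rfl⟩,
    ⟨D' (bv n S), hD' _ (bv_mem_LamA n S), by rw [hD1']; rfl⟩⟩, fun x hx => ⟨?_, ?_⟩⟩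
  · rw [← LinearMap.smul_apply, hD2]
    exact hD x hx
  · rw [← LinearMap.smul_apply, hD2']
    exact hD' x hx

end
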